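/- Let 0 < ε < 1/2. Suppose R₂ ≥ 0 satisfies −log(1 − y) ≤ y + R₂·y² for all y ∈ [0, 1/4], and suppose D₁ ≥ 0 satisfies −( log(sinc((π − x)/2)) + log(sinc((π + x)/2)) − 2·log(sinc(π/2)) ) ≤ D₁·x² for all x ∈ (0, ε], where sinc y = sin y / y. Set c₂ = ∫₀^π y·√(log(1 + 1/y)) dy and, for x ∈ (0, ε], U₂(x) = −∫ₓ^π I(x,y)·y·√(log(1 + 1/y)) dy. Then for all x ∈ (0, ε]: U₂(x)/( −x²·log x·√(log(1 + 1/x)) ) ≤ log(16/(3√3))/log(1/x) + ( (2/3)·log(1/(2x))^{3/2}/( log(1/x)·√(log(1 + 1/x)) ) + R₂·√(log(1/(2x)))/( 8·log(1/x)·√(log(1 + 1/x)) ) − R₂·(1 − 4x²)/( 16·√(log(1/(2x)))·log(1/x)·√(log(1 + 1/x)) ) + √(log 2)/√(log(1 + 1/x)) − (log 2)^{3/2}/( log(1/x)·√(log(1 + 1/x)) ) + R₂·√(log 2)·(1 − 4x²)/( 8·log(1/x)·√(log(1 + 1/x)) ) ) + ( √(log 2)/( log(1/x)·√(log(1 + 1/x))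 ) )·( (1/2)·log( (π² − x²)/(1 − x²) ) + log(1 − x²)/(2x²) − log(1 − x²/π²)/(2x²) ) + D₁·c₂/( log(1/x)·√(log(1 + 1/x)) ). -/

import Mathlib

open Set

/-- `sinc y = sin y / y`. -/
noncomputable def sinc (y : ℝ) : ℝ := Real.sin y / y

/-- The kernel `I(x,y) = log( sin((y−x)/2)·sin((x+y)/2) / sin(y/2)² )`. -/
noncomputable def Iker (x y : ℝ) : ℝ :=
  Real.log (Real.sin ((y - x) / 2) * Real.sin ((x + y) / 2) / Real.sin (y / 2) ^ 2)

/-- `c₂ = ∫₀^π y·√(log(1 + 1/y)) dy`. -/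
noncomputable def c₂ : ℝ :=
  ∫ y in (0:ℝ)..Real.pi, y * Real.sqrt (Real.log (1 + 1 / y))

/-- `U₂(x) = −∫ₓ^π I(x,y)·y·√(log(1 + 1/y)) dy`. -/
noncomputable def U₂ (x : ℝ) : ℝ :=
  -∫ y in x..Real.pi, Iker x y * (y * Real.sqrt (Real.log (1 + 1 / y)))

open Filter Topology in
/-- Euler's product for `sin (z / 2) / (z / 2)`. -/
lemma tendsto_prod_sin_half {z : ℝ} (hz : z ≠ 0) :
    Tendsto (fun n : ℕ => ∏ j ∈ Finset.range n,
      (1 - z ^ 2 / (2 * Real.pi * ((j : ℝ) + 1)) ^ 2)) atTop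
      (𝓝 (Real.sin (z / 2) / (z / 2))) := by
  have hp : Real.pi ≠ 0 := Real.pi_ne_zero
  have h := (Real.tendsto_euler_sin_prod (z / (2 * Real.pi))).div_const (z / 2)
  have e : Real.pi * (z / (2 * Real.pi)) = z / 2 := by field_simp
  rw [e] at h
  refine h.congr fun n => ?_
  rw [mul_div_cancel_left₀ _ (by positivity)]
  refine Finset.prod_congr rfl fun j _ => ?_
  rw [div_pow, mul_pow _ ((j : ℝ) + 1), div_div]

/-- The contribution of the zeros `± A` of `sin (· / 2)` to the kernel. -/
noncomputable def zeroFactor (x y A : ℝ) : ℝ :=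
  1 - (2 * x ^ 2 * (A ^ 2 + y ^ 2) - x ^ 4) / (A ^ 2 - y ^ 2) ^ 2

lemma zeroFactor_eq {x y A : ℝ} (hA : A ≠ 0) (h : A ^ 2 - y ^ 2 ≠ 0) :
    zeroFactor x y A =
      (1 - (y - x) ^ 2 / A ^ 2) * (1 - (y + x) ^ 2 / A ^ 2) / (1 - y ^ 2 / A ^ 2) ^ 2 := by
  have h' : (1 - y ^ 2 / A ^ 2) ≠ 0 := by
    rw [one_sub_div (by positivity)]
    positivity
  rw [zeroFactor, eq_div_iff (by positivity)]
  field_simp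
  ring

lemma zeroFactor_le_one {x y A : ℝ} (h : x ^ 2 ≤ 2 * A ^ 2) : zeroFactor x y A ≤ 1 := by
  have : 0 ≤ (2 * x ^ 2 * (A ^ 2 + y ^ 2) - x ^ 4) / (A ^ 2 - y ^ 2) ^ 2 := by
    apply div_nonneg _ (sq_nonneg _)
    nlinarith [sq_nonneg x, mul_nonneg (sq_nonneg x) (sq_nonneg y),
      mul_nonneg (sq_nonneg x) (sub_nonneg.2 h)]
  unfold zeroFactor
  linarith

lemma zeroFactor_pos {x y A : ℝ} (hx : 0 ≤ x) (hy : 0 ≤ y) (h : x + y < A) :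
    0 < zeroFactor x y A := by
  have h1 : 0 < (A ^ 2 - y ^ 2) ^ 2 := by
    apply pow_pos
    nlinarith
  rw [zeroFactor, sub_pos, div_lt_one h1]
  have h2 : 0 < (A - x - y) * (A + x + y) := by
    apply mul_pos <;> linarith
  have h3 : 0 < (A - x + y) * (A + x - y) := by
    apply mul_pos <;> linarith
  nlinarith [mul_pos h2 h3]

lemma zeroFactor_anti {x y z A : ℝ} (hx : x ^ 2 ≤ 2 * A ^ 2) (hy : 0 ≤ y) (hyz : y ≤ z)
    (hz : z < A) : zeroFactor x z A ≤ zeroFactor x y A := by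
  have h1 : y ^ 2 ≤ z ^ 2 := by gcongr
  have h2 : z ^ 2 < A ^ 2 := by
    have : 0 ≤ z := hy.trans hyz
    gcongr
  have h3 : 0 < A ^ 2 - z ^ 2 := by linarith
  have h4 : 0 ≤ 2 * x ^ 2 * (A ^ 2 + y ^ 2) - x ^ 4 := by
    nlinarith [sq_nonneg x, mul_nonneg (sq_nonneg x) (sq_nonneg y),
      mul_nonneg (sq_nonneg x) (sub_nonneg.2 hx)]
  unfold zeroFactor
  have : 2 * x ^ 2 * (A ^ 2 + y ^ 2) - x ^ 4 ≤ 2 * x ^ 2 * (A ^ 2 + z ^ 2) - x ^ 4 := by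
    gcongr
  gcongr
  · linarith

/-- `exp (Iker x y)` divided by its singular part `1 - x² / y²`. -/
noncomputable def kerRatio (x y : ℝ) : ℝ :=
  Real.sin ((y - x) / 2) / ((y - x) / 2) * (Real.sin ((y + x) / 2) / ((y + x) / 2)) /
    (Real.sin (y / 2) / (y / 2)) ^ 2

lemma lt_two_pi_mul {y : ℝ} (hy' : y ≤ Real.pi) (j : ℕ) :
    y + 1 < 2 * Real.pi * ((j : ℝ) + 1) := by
  have h := Real.pi_gt_three
  nlinarith [mul_nonneg Real.pi_pos.le (Nat.cast_nonneg (α := ℝ) j)]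

open Filter Topology in
lemma tendsto_prod_zeroFactor {x y : ℝ} (hx : 0 < x) (hxy : x < y) (hy : y ≤ Real.pi) :
    Tendsto (fun n : ℕ => ∏ j ∈ Finset.range n, zeroFactor x y (2 * Real.pi * ((j : ℝ) + 1)))
      atTop (𝓝 (kerRatio x y)) := by
  have hy0 : 0 < y := hx.trans hxy
  have hs : 0 < Real.sin (y / 2) := Real.sin_pos_of_pos_of_lt_pi (by linarith) (by linarith)
  have h := ((tendsto_prod_sin_half (sub_ne_zero.2 hxy.ne')).mul
    (tendsto_prod_sin_half (by positivity : y + x ≠ 0))).div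
    ((tendsto_prod_sin_half hy0.ne').pow 2) (by positivity)
  refine h.congr fun n => ?_
  simp only [Pi.div_apply]
  rw [← Finset.prod_mul_distrib, ← Finset.prod_pow, ← Finset.prod_div_distrib]
  refine Finset.prod_congr rfl fun j _ => ?_
  have h1 := lt_two_pi_mul hy j
  rw [zeroFactor_eq (by linarith)]
  nlinarith

lemma kerRatio_pos {x y : ℝ} (hx : 0 < x) (hxy : x < y) (hy : y ≤ Real.pi) :
    0 < kerRatio x y := by
  have hs : 0 < Real.sin (y / 2) := Real.sin_pos_of_pos_of_lt_pi (by linarith) (by linarith)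
  have hs1 : 0 < Real.sin ((y - x) / 2) :=
    Real.sin_pos_of_pos_of_lt_pi (by linarith) (by linarith)
  have hs2 : 0 < Real.sin ((y + x) / 2) :=
    Real.sin_pos_of_pos_of_lt_pi (by linarith) (by linarith)
  have : 0 < y - x := by linarith
  have : 0 < y := by linarith
  unfold kerRatio
  positivity

lemma kerRatio_pi_mul_le {x y : ℝ} (hx : 0 < x) (hx1 : x < 1) (hxy : x < y) (hy : y ≤ Real.pi) :
    kerRatio x Real.pi * zeroFactor x y (2 * Real.pi) ≤
      zeroFactor x Real.pi (2 * Real.pi) * kerRatio x y := by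
  have hpi := Real.pi_gt_three
  have t1 := (((Filter.tendsto_add_atTop_iff_nat 1).2
    (tendsto_prod_zeroFactor hx (hxy.trans_le hy) le_rfl))).mul_const
      (zeroFactor x y (2 * Real.pi))
  have t2 := (((Filter.tendsto_add_atTop_iff_nat 1).2
    (tendsto_prod_zeroFactor hx hxy hy))).const_mul (zeroFactor x Real.pi (2 * Real.pi))
  refine le_of_tendsto_of_tendsto' t1 t2 fun n => ?_
  rw [Finset.prod_range_succ', Finset.prod_range_succ']
  have key : ∏ k ∈ Finset.range n, zeroFactor x Real.pi (2 * Real.pi * (((k + 1 : ℕ) : ℝ) + 1)) ≤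
      ∏ k ∈ Finset.range n, zeroFactor x y (2 * Real.pi * (((k + 1 : ℕ) : ℝ) + 1)) := by
    refine Finset.prod_le_prod (fun k _ => ?_) fun k _ => ?_
    · have := lt_two_pi_mul le_rfl (k + 1)
      exact (zeroFactor_pos hx.le Real.pi_pos.le (by linarith)).le
    · have := lt_two_pi_mul le_rfl (k + 1)
      exact zeroFactor_anti (by nlinarith) (by linarith) hy (by linarith)
  have p1 : 0 < zeroFactor x y (2 * Real.pi) :=
    zeroFactor_pos hx.le (by linarith) (by linarith)
  have p2 : 0 < zeroFactor x Real.pi (2 * Real.pi) :=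
    zeroFactor_pos hx.le (by linarith) (by linarith)
  simp only [Nat.cast_zero, zero_add, mul_one]
  nlinarith [mul_le_mul_of_nonneg_right key (mul_pos p1 p2).le]

lemma kerRatio_pi_le {x : ℝ} (hx : 0 < x) (hx1 : x < 1) :
    kerRatio x Real.pi ≤ zeroFactor x Real.pi (2 * Real.pi) := by
  have hpi := Real.pi_gt_three
  refine le_of_tendsto ((Filter.tendsto_add_atTop_iff_nat 1).2
    (tendsto_prod_zeroFactor hx (by linarith) le_rfl)) (Filter.Eventually.of_forall fun n => ?_)
  rw [Finset.prod_range_succ']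
  simp only [Nat.cast_zero, zero_add, mul_one]
  refine mul_le_of_le_one_left
    (zeroFactor_pos hx.le Real.pi_pos.le (by linarith)).le
    (Finset.prod_le_one (fun k _ => ?_) fun k _ => ?_)
  · have := lt_two_pi_mul le_rfl (k + 1)
    exact (zeroFactor_pos hx.le Real.pi_pos.le (by linarith)).le
  · have := lt_two_pi_mul le_rfl (k + 1)
    exact zeroFactor_le_one (by nlinarith)

/-- A lower bound for the growth of the regular part of the kernel from `y` to `π`. -/
noncomputable def kerGap (y : ℝ) : ℝ :=
  (1 - y ^ 2 / Real.pi ^ 2) * (3 / 5 + y ^ 2 / Real.pi ^ 2 / 4) / Real.pi ^ 2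

lemma log_zeroFactor_sub_le {x y : ℝ} (hx : 0 < x) (hx1 : x < 1 / 2) (hy0 : 0 ≤ y)
    (hy : y ≤ Real.pi) :
    Real.log (zeroFactor x Real.pi (2 * Real.pi)) - Real.log (zeroFactor x y (2 * Real.pi)) ≤
      -(x ^ 2 * kerGap y) := by
  have hpi := Real.pi_gt_three
  have p1 : 0 < zeroFactor x y (2 * Real.pi) := zeroFactor_pos hx.le (by linarith) (by linarith)
  have p2 : 0 < zeroFactor x Real.pi (2 * Real.pi) :=
    zeroFactor_pos hx.le (by linarith) (by linarith)
  have le1 : zeroFactor x y (2 * Real.pi) ≤ 1 := zeroFactor_le_one (by nlinarith)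
  have anti : zeroFactor x Real.pi (2 * Real.pi) ≤ zeroFactor x y (2 * Real.pi) :=
    zeroFactor_anti (by nlinarith) hy0 hy (by linarith)
  rw [← Real.log_div p2.ne' p1.ne']
  refine (Real.log_le_sub_one_of_pos (div_pos p2 p1)).trans ?_
  have s1 : zeroFactor x Real.pi (2 * Real.pi) / zeroFactor x y (2 * Real.pi) - 1 ≤
      zeroFactor x Real.pi (2 * Real.pi) - zeroFactor x y (2 * Real.pi) := by
    rw [div_sub_one p1.ne', div_le_iff₀ p1]
    nlinarith
  refine s1.trans ?_
  obtain ⟨t, rfl⟩ : ∃ t, y = Real.pi * t := ⟨y / Real.pi, by field_simp⟩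
  obtain ⟨e, he⟩ : ∃ e, x = Real.pi * e := ⟨x / Real.pi, by field_simp⟩
  have hp : Real.pi ≠ 0 := Real.pi_ne_zero
  have ht0 : 0 ≤ t := nonneg_of_mul_nonneg_right hy0 Real.pi_pos
  have ht1 : t ≤ 1 := by
    by_contra! hc
    nlinarith
  have he2 : e ^ 2 ≤ 1 / 36 := by
    have : e ≤ 1 / 6 := by
      by_contra! hc
      nlinarith
    have : 0 ≤ e := nonneg_of_mul_nonneg_right (he ▸ hx.le) Real.pi_pos
    nlinarith
  have hs0 : 0 ≤ t ^ 2 := sq_nonneg t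
  have hs1 : t ^ 2 ≤ 1 := by nlinarith
  have e1 : zeroFactor x (Real.pi * t) (2 * Real.pi) =
      1 - e ^ 2 * ((8 + 2 * t ^ 2 - e ^ 2) / (4 - t ^ 2) ^ 2) := by
    have : 4 - t ^ 2 ≠ 0 := by linarith
    have : (2 * Real.pi) ^ 2 - (Real.pi * t) ^ 2 ≠ 0 := by
      rw [show (2 * Real.pi) ^ 2 - (Real.pi * t) ^ 2 = Real.pi ^ 2 * (4 - t ^ 2) by ring]
      positivity
    rw [zeroFactor, he, show (2 * Real.pi) ^ 2 - (Real.pi * t) ^ 2 = Real.pi ^ 2 * (4 - t ^ 2) by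
      ring]
    field_simp
    ring
  have e2 : zeroFactor x Real.pi (2 * Real.pi) = 1 - e ^ 2 * ((10 - e ^ 2) / 9) := by
    rw [zeroFactor, he]
    field_simp
    ring
  have e3 : x ^ 2 * kerGap (Real.pi * t) = e ^ 2 * ((1 - t ^ 2) * (3 / 5 + t ^ 2 / 4)) := by
    rw [kerGap, he]
    field_simp
  rw [e1, e2, e3]
  have key : (8 + 2 * t ^ 2 - e ^ 2) / (4 - t ^ 2) ^ 2 ≤
      (10 - e ^ 2) / 9 - (1 - t ^ 2) * (3 / 5 + t ^ 2 / 4) := by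
    generalize t ^ 2 = s at *
    generalize e ^ 2 = d at *
    rw [div_le_iff₀ (by nlinarith)]
    have : 0 ≤ (1 - s) * (88 - 10 * s - d * (7 - s) - 9 * (4 - s) ^ 2 * (3 / 5 + s / 4)) := by
      apply mul_nonneg (by linarith)
      nlinarith [mul_nonneg hs0 (sub_nonneg.2 hs1), mul_nonneg hs0 hs0, sq_nonneg (s - 1 / 4),
        mul_nonneg hs0 (sq_nonneg (s - 1 / 4)), mul_nonneg hs0 (sq_nonneg (s - 1 / 2))]
    nlinarith
  nlinarith [mul_le_mul_of_nonneg_left key (sq_nonneg e)]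

/-- The regular part of the kernel is controlled by its value at `y = π`, with a gap. -/
lemma neg_log_kerRatio_le {x y : ℝ} (hx : 0 < x) (hx1 : x < 1 / 2) (hxy : x < y)
    (hy : y ≤ Real.pi) :
    -Real.log (kerRatio x y) ≤ -Real.log (kerRatio x Real.pi) - x ^ 2 * kerGap y := by
  have hpi := Real.pi_gt_three
  have p1 : 0 < zeroFactor x y (2 * Real.pi) := zeroFactor_pos hx.le (by linarith) (by linarith)
  have p2 : 0 < zeroFactor x Real.pi (2 * Real.pi) :=
    zeroFactor_pos hx.le (by linarith) (by linarith)
  have p3 := kerRatio_pos hx hxy hy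
  have p4 := kerRatio_pos hx (hxy.trans_le hy) le_rfl
  have h := Real.log_le_log (by positivity) (kerRatio_pi_mul_le hx (by linarith) hxy hy)
  rw [Real.log_mul p4.ne' p1.ne', Real.log_mul p2.ne' p3.ne'] at h
  linarith [log_zeroFactor_sub_le hx hx1 (by linarith) hy]

lemma sq_mul_kerGap_le {x y : ℝ} (hx : 0 < x) (hx1 : x < 1 / 2) (hy0 : 0 ≤ y)
    (hy : y ≤ Real.pi) :
    x ^ 2 * kerGap y ≤ -Real.log (kerRatio x Real.pi) := by
  have hpi := Real.pi_gt_three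
  have p1 : zeroFactor x y (2 * Real.pi) ≤ 1 := zeroFactor_le_one (by nlinarith)
  have p1' : 0 < zeroFactor x y (2 * Real.pi) := zeroFactor_pos hx.le hy0 (by linarith)
  have h1 := Real.log_le_log (kerRatio_pos hx (by linarith) le_rfl)
    (kerRatio_pi_le hx (by linarith))
  linarith [log_zeroFactor_sub_le hx hx1 hy0 hy, Real.log_nonpos p1'.le p1]

lemma Iker_eq {x y : ℝ} (hx : 0 < x) (hxy : x < y) (hy : y ≤ Real.pi) :
    Iker x y = Real.log (1 - x ^ 2 / y ^ 2) + Real.log (kerRatio x y) := by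
  have hy0 : 0 < y := hx.trans hxy
  have hs : 0 < Real.sin (y / 2) := Real.sin_pos_of_pos_of_lt_pi (by linarith) (by linarith)
  have h1 : 0 < 1 - x ^ 2 / y ^ 2 := by
    rw [sub_pos, div_lt_one (by positivity)]
    gcongr
  rw [← Real.log_mul h1.ne' (kerRatio_pos hx hxy hy).ne', Iker, kerRatio]
  congr 1
  have : y - x ≠ 0 := by linarith
  have : y + x ≠ 0 := by linarith
  rw [add_comm x y]
  field_simp
  ring

lemma Iker_nonpos {x y : ℝ} (hx : 0 < x) (hxy : x < y) (hy : y ≤ Real.pi) : Iker x y ≤ 0 := by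
  have hs : 0 < Real.sin (y / 2) := Real.sin_pos_of_pos_of_lt_pi (by linarith) (by linarith)
  have hs1 : 0 < Real.sin ((y - x) / 2) :=
    Real.sin_pos_of_pos_of_lt_pi (by linarith) (by linarith)
  have hs2 : 0 < Real.sin ((x + y) / 2) :=
    Real.sin_pos_of_pos_of_lt_pi (by linarith) (by linarith)
  refine Real.log_nonpos (by positivity) ?_
  rw [div_le_one (by positivity), show (y - x) / 2 = y / 2 - x / 2 by ring,
    show (x + y) / 2 = y / 2 + x / 2 by ring, Real.sin_sub, Real.sin_add]
  nlinarith [Real.sin_sq_add_cos_sq (y / 2), Real.sin_sq_add_cos_sq (x / 2),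
    sq_nonneg (Real.sin (x / 2)), sq_nonneg (Real.cos (x / 2))]

lemma log_kerRatio_pi {x : ℝ} (hx : 0 < x) (hx1 : x < Real.pi) :
    Real.log (kerRatio x Real.pi) = Real.log (sinc ((Real.pi - x) / 2)) +
      Real.log (sinc ((Real.pi + x) / 2)) - 2 * Real.log (sinc (Real.pi / 2)) := by
  have hs1 : 0 < Real.sin ((Real.pi - x) / 2) :=
    Real.sin_pos_of_pos_of_lt_pi (by linarith) (by linarith)
  have hs2 : 0 < Real.sin ((Real.pi + x) / 2) :=
    Real.sin_pos_of_pos_of_lt_pi (by linarith) (by linarith)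
  have : 0 < Real.pi - x := by linarith
  have hp := Real.pi_pos
  unfold kerRatio sinc
  rw [Real.log_div, Real.log_mul, Real.log_pow]
  · norm_num
  all_goals first | positivity | (rw [Real.sin_pi_div_two]; positivity)

lemma log_one_add_le_pade {u : ℝ} (hu : 0 ≤ u) :
    Real.log (1 + u) ≤ u * (6 + u) / (6 + 4 * u) := by
  have hd : ∀ v ∈ Ici (0 : ℝ), HasDerivAt
      (fun v : ℝ => v * (6 + v) / (6 + 4 * v) - Real.log (1 + v))
      (4 * v ^ 3 / ((6 + 4 * v) ^ 2 * (1 + v))) v := by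
    intro v hv
    have hv : 0 ≤ v := hv
    have h1 : HasDerivAt (fun v : ℝ => v * (6 + v)) (1 * (6 + v) + v * 1) v :=
      (hasDerivAt_id v).mul ((hasDerivAt_id v).const_add 6)
    have h2 : HasDerivAt (fun v : ℝ => 6 + 4 * v) (4 * 1) v :=
      ((hasDerivAt_id v).const_mul 4).const_add 6
    have h3 : HasDerivAt (fun v : ℝ => Real.log (1 + v)) (1 / (1 + v)) v :=
      ((hasDerivAt_id v).const_add 1).log (by positivity)
    have h4 : 6 + 4 * v ≠ 0 := by positivity
    refine ((h1.div h2 h4).sub h3).congr_deriv ?_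
    have : 1 + v ≠ 0 := by positivity
    field_simp
    ring
  have hm : MonotoneOn (fun v : ℝ => v * (6 + v) / (6 + 4 * v) - Real.log (1 + v)) (Ici 0) := by
    refine monotoneOn_of_deriv_nonneg (convex_Ici 0)
      (fun v hv => (hd v hv).continuousAt.continuousWithinAt)
      (fun v hv => (hd v (interior_subset hv)).differentiableAt.differentiableWithinAt)
      fun v hv => ?_
    rw [(hd v (interior_subset hv)).deriv]
    have : 0 ≤ v := interior_subset hv
    positivity
  have h := hm (mem_Ici.2 le_rfl) hu hu
  norm_num at h
  linarith

lemma add_sq_div_two_le_neg_log {v : ℝ} (h0 : 0 ≤ v) (h1 : v < 1) :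
    v + v ^ 2 / 2 ≤ -Real.log (1 - v) := by
  have h2 : 0 < 1 - v := by linarith
  have h := Real.le_log_one_add_of_nonneg (div_nonneg h0 h2.le)
  rw [show 1 + v / (1 - v) = (1 - v)⁻¹ by field_simp; ring, Real.log_inv] at h
  refine le_trans ?_ h
  have e : 2 * (v / (1 - v)) / (v / (1 - v) + 2) = 2 * v / (2 - v) := by
    have : 2 - v ≠ 0 := by linarith
    have : v + 2 * (1 - v) ≠ 0 := by linarith
    field_simp
    ring
  rw [e, le_div_iff₀ (by linarith)]
  nlinarith [mul_nonneg h0 (mul_nonneg h0 h0)]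

/-- The weight `√(log (1 + 1 / y))`. -/
noncomputable def wt (y : ℝ) : ℝ := Real.sqrt (Real.log (1 + 1 / y))

lemma wt_nonneg (y : ℝ) : 0 ≤ wt y := Real.sqrt_nonneg _

lemma log_one_add_inv_pos {y : ℝ} (hy : 0 < y) : 0 < Real.log (1 + 1 / y) :=
  Real.log_pos (by linarith [one_div_pos.2 hy])

lemma wt_pos {y : ℝ} (hy : 0 < y) : 0 < wt y := Real.sqrt_pos.2 (log_one_add_inv_pos hy)

lemma wt_sq {y : ℝ} (hy : 0 < y) : wt y ^ 2 = Real.log (1 + 1 / y) :=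
  Real.sq_sqrt (log_one_add_inv_pos hy).le

lemma wt_one : wt 1 = Real.sqrt (Real.log 2) := by norm_num [wt]

lemma wt_le_wt {y z : ℝ} (hy : 0 < y) (hyz : y ≤ z) : wt z ≤ wt y := by
  unfold wt
  have : 0 < z := hy.trans_le hyz
  gcongr

lemma continuousOn_wt : ContinuousOn wt (Ioi 0) := by
  unfold wt
  refine ContinuousOn.sqrt (ContinuousOn.log ?_ ?_)
  · exact continuousOn_const.add (continuousOn_const.div continuousOn_id fun y hy => ne_of_gt hy)
  · intro y hy
    have : (0 : ℝ) < y := hy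
    positivity

lemma sqrt_le_half_div_add {s p : ℝ} (hs : 0 ≤ s) (hp : 0 < p) :
    Real.sqrt s ≤ (s / p + p) / 2 := by
  have h : (s / p + p) / 2 - Real.sqrt s = (Real.sqrt s - p) ^ 2 / (2 * p) := by
    field_simp
    linear_combination -Real.sq_sqrt hs
  have : 0 ≤ (Real.sqrt s - p) ^ 2 / (2 * p) := by positivity
  linarith

lemma log_one_add_inv_le {y : ℝ} (hy : 0 < y) (hy1 : y ≤ 1) :
    Real.log (1 + 1 / y) ≤ Real.log (1 / y) + Real.log 2 := by
  rw [← Real.log_mul (by positivity) (by norm_num)]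
  have : 1 ≤ 1 / y := by rwa [le_div_iff₀ hy, one_mul]
  exact Real.log_le_log (by positivity) (by linarith)

lemma log_inv_nonneg {y : ℝ} (hy : 0 < y) (hy1 : y ≤ 1) : 0 ≤ Real.log (1 / y) :=
  Real.log_nonneg (by rwa [le_div_iff₀ hy, one_mul])

lemma wt_le_sqrt_add_sqrt {y : ℝ} (hy : 0 < y) (hy1 : y ≤ 1) :
    wt y ≤ Real.sqrt (Real.log (1 / y)) + Real.sqrt (Real.log 2) := by
  refine (Real.sqrt_le_sqrt (log_one_add_inv_le hy hy1)).trans ?_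
  rw [Real.sqrt_le_left (by positivity)]
  have h1 := Real.sq_sqrt (log_inv_nonneg hy hy1)
  have h2 := Real.sq_sqrt (Real.log_pos one_lt_two).le
  nlinarith [Real.sqrt_nonneg (Real.log (1 / y)), Real.sqrt_nonneg (Real.log 2),
    mul_nonneg (Real.sqrt_nonneg (Real.log (1 / y))) (Real.sqrt_nonneg (Real.log 2))]

lemma wt_le_of_pos {y p : ℝ} (hy : 0 < y) (hy1 : y ≤ 1) (hp : 0 < p) :
    wt y ≤ ((Real.log (1 / y) + Real.log 2) / p + p) / 2 := by
  refine (sqrt_le_half_div_add (log_one_add_inv_pos hy).le hp).trans ?_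
  gcongr
  exact log_one_add_inv_le hy hy1

lemma tangent_le_wt {y : ℝ} (hy : 0 < y) (hy1 : y ≤ 17 / 2) : 25 / 27 - 4 / 27 * y ≤ wt y := by
  apply Real.le_sqrt_of_sq_le
  have h := Real.le_log_one_add_of_nonneg (one_div_pos.2 hy).le
  refine le_trans ?_ h
  rw [show 2 * (1 / y) / (1 / y + 2) = 2 / (2 * y + 1) by field_simp; ring,
    le_div_iff₀ (by positivity)]
  nlinarith [mul_nonneg (sq_nonneg (y - 7 / 4)) (sub_nonneg.2 hy1)]

lemma wt_sub_ge {x y : ℝ} (hx : 0 < x) (hx1 : x ≤ 1 / 2) (hxy : x ≤ y) (hy : y ≤ 2 * x) :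
    y * wt y ≤ y * wt x -
      ((y - x) + (y - x) ^ 2 / (6 * x)) / (2 * wt x * (1 + x)) := by
  have hy0 : 0 < y := hx.trans_le hxy
  have hw := wt_pos hx
  have hle := wt_le_wt hx hxy
  set v := (y - x) / (y * (1 + x)) with hv
  have hv0 : 0 ≤ v := div_nonneg (by linarith) (by positivity)
  have hv1 : v < 1 := by
    rw [hv, div_lt_one (by positivity)]
    nlinarith [mul_pos hy0 hx]
  have h1 : wt x ^ 2 - wt y ^ 2 = -Real.log (1 - v) := by
    rw [wt_sq hx, wt_sq hy0, ← Real.log_div (by positivity) (by positivity), ← Real.log_inv]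
    congr 1
    rw [hv, one_sub_div (by positivity), inv_div, show y * (1 + x) - (y - x) = x * (y + 1) by ring]
    field_simp
    ring
  have h2 := add_sq_div_two_le_neg_log hv0 hv1
  have h3 : ((y - x) + (y - x) ^ 2 / (6 * x)) / (1 + x) ≤ y * (v + v ^ 2 / 2) := by
    have e : y * (v + v ^ 2 / 2) =
        ((y - x) + (y - x) ^ 2 / (2 * y * (1 + x))) / (1 + x) := by
      rw [hv]
      field_simp
    rw [e]
    have h5 : 2 * y * (1 + x) ≤ 6 * x := by nlinarith
    have h6 := div_le_div_of_nonneg_left (sq_nonneg (y - x)) (by positivity) h5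
    gcongr
  have h4 : ((y - x) + (y - x) ^ 2 / (6 * x)) / (2 * wt x * (1 + x)) ≤ y * (wt x - wt y) := by
    rw [show 2 * wt x * (1 + x) = (1 + x) * (2 * wt x) by ring, ← div_div,
      div_le_iff₀ (by positivity)]
    calc _ ≤ y * (v + v ^ 2 / 2) := h3
      _ ≤ y * (wt x ^ 2 - wt y ^ 2) := by
        rw [h1]
        gcongr
      _ ≤ _ := by
        nlinarith [mul_nonneg hy0.le (mul_nonneg (sub_nonneg.2 hle) (sub_nonneg.2 hle))]
  linarith

lemma log_two_bounds : 0.69314718 < Real.log 2 ∧ Real.log 2 < 0.69314719 :=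
  ⟨by linarith [Real.log_two_gt_d9], by linarith [Real.log_two_lt_d9]⟩

lemma sqrt_log_two_bounds : 0.83255 < √(Real.log 2) ∧ √(Real.log 2) < 0.83256 := by
  have h := log_two_bounds
  constructor
  · exact Real.lt_sqrt_of_sq_lt (by norm_num; linarith [h.1])
  · exact (Real.sqrt_lt' (by norm_num)).2 (by norm_num; linarith [h.2])

lemma log_pi_gt : 1.1446 < Real.log Real.pi := by
  have hp := Real.pi_gt_d4
  have h1 : Real.log (3 * (1 + 0.04716)) ≤ Real.log Real.pi :=
    Real.log_le_log (by norm_num) (by norm_num; linarith)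
  rw [Real.log_mul (by norm_num) (by norm_num)] at h1
  have h2 := Real.le_log_one_add_of_nonneg (x := 0.04716) (by norm_num)
  have h3 := Real.log_three_gt_d9
  norm_num at h1 h2 h3 ⊢
  linarith

/-- `∫ y in 1..π, wt y / y`, bounded by the inequality of arithmetic and geometric means. -/
lemma integral_wt_div_le : ∫ y in (1 : ℝ)..Real.pi, wt y / y ≤ 0.7715 := by
  have hp := Real.pi_gt_d4
  have hp' := Real.pi_lt_d4
  have h1p : (1 : ℝ) ≤ Real.pi := by linarith
  have hpos : ∀ y ∈ Icc (1 : ℝ) Real.pi, 0 < y := fun y hy => by linarith [hy.1]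
  set F : ℝ → ℝ := fun y => ((1 / 4 * Real.log y - 5 / 2 * Real.log (y + 1) +
    9 / 4 * Real.log (6 * y + 4)) / 0.42 + 0.42 * (Real.log y - 1 / y)) / 2 with hF
  set f : ℝ → ℝ := fun y =>
    ((6 * y + 1) / (y * (6 * y + 4)) / (0.42 * (1 + 1 / y)) + 0.42 * (1 + 1 / y)) / 2 / y with hf
  have hd : ∀ y ∈ Icc (1 : ℝ) Real.pi, HasDerivAt F (f y) y := by
    intro y hy
    have hy0 := hpos y hy
    have d1 := Real.hasDerivAt_log hy0.ne'
    have d2 : HasDerivAt (fun y : ℝ => Real.log (y + 1)) (1 / (y + 1)) y :=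
      ((hasDerivAt_id y).add_const 1).log (by positivity)
    have d3 : HasDerivAt (fun y : ℝ => Real.log (6 * y + 4)) (6 * 1 / (6 * y + 4)) y :=
      (((hasDerivAt_id y).const_mul 6).add_const 4).log (by positivity)
    have d4 : HasDerivAt (fun y : ℝ => 1 / y) (-(y ^ 2)⁻¹) y := by
      simpa using hasDerivAt_inv hy0.ne'
    refine ((((((d1.const_mul (1 / 4)).sub (d2.const_mul (5 / 2))).add
      (d3.const_mul (9 / 4))).div_const 0.42).add
      ((d1.sub d4).const_mul 0.42)).div_const 2).congr_deriv ?_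
    simp only [hf]
    have : y + 1 ≠ 0 := by positivity
    have : 1 + y ≠ 0 := by positivity
    have : 6 * y + 4 ≠ 0 := by positivity
    field_simp
    ring
  have hfc : ContinuousOn f (Icc 1 Real.pi) := by
    have := hpos
    simp only [hf]
    intro y hy
    have hy0 := hpos y hy
    apply ContinuousAt.continuousWithinAt
    have : 0.42 * (1 + 1 / y) ≠ 0 := by positivity
    fun_prop (disch := positivity)
  have hfi : IntervalIntegrable f MeasureTheory.volume 1 Real.pi :=
    hfc.intervalIntegrable_of_Icc h1p
  have hwi : IntervalIntegrable (fun y => wt y / y) MeasureTheory.volume 1 Real.pi :=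
    ((continuousOn_wt.mono hpos).div continuousOn_id fun y hy =>
      (hpos y hy).ne').intervalIntegrable_of_Icc h1p
  have hle := intervalIntegral.integral_mono_on h1p hwi hfi fun y hy => by
    have hy0 := hpos y hy
    simp only [hf]
    gcongr
    refine (sqrt_le_half_div_add (log_one_add_inv_pos hy0).le (by positivity)
      (p := 0.42 * (1 + 1 / y))).trans ?_
    gcongr
    refine (log_one_add_le_pade (one_div_pos.2 hy0).le).trans_eq ?_
    field_simp
  rw [intervalIntegral.integral_eq_sub_of_hasDerivAt_of_le h1p
    (fun y hy => (hd y hy).continuousAt.continuousWithinAt)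
    (fun y hy => hd y (Ioo_subset_Icc_self hy)) hfi] at hle
  refine hle.trans ?_
  have l1 := log_pi_gt
  have l1' : Real.log Real.pi ≤ 1.1449 := by
    have h1 : Real.log Real.pi ≤ Real.log (3 * (1 + 0.0472)) :=
      Real.log_le_log (by linarith) (by norm_num; linarith)
    rw [Real.log_mul (by norm_num) (by norm_num)] at h1
    have h2 := log_one_add_le_pade (u := 0.0472) (by norm_num)
    have h3 := Real.log_three_lt_d9
    norm_num at h1 h2 h3 ⊢
    linarith
  have l2 : Real.log 2 + 0.7279 ≤ Real.log (Real.pi + 1) := by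
    have h1 : Real.log (2 * (2 * (1 + 0.035375))) ≤ Real.log (Real.pi + 1) :=
      Real.log_le_log (by norm_num) (by norm_num; linarith)
    rw [Real.log_mul (by norm_num) (by norm_num), Real.log_mul (by norm_num) (by norm_num)] at h1
    have h2 := Real.le_log_one_add_of_nonneg (x := 0.035375) (by norm_num)
    have h3 := Real.log_two_gt_d9
    norm_num at h1 h2 h3 ⊢
    linarith
  have l3 : Real.log (6 * Real.pi + 4) ≤ Real.log 10 + 0.82637 := by
    have h1 : Real.log (6 * Real.pi + 4) ≤ Real.log (10 * (2 * (1 + 0.14248))) :=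
      Real.log_le_log (by linarith) (by norm_num; linarith)
    rw [Real.log_mul (by norm_num) (by norm_num), Real.log_mul (by norm_num) (by norm_num)] at h1
    have h2 := log_one_add_le_pade (u := 0.14248) (by norm_num)
    have h3 := Real.log_two_lt_d9
    norm_num at h1 h2 h3 ⊢
    linarith
  have l4 : 0.3183 ≤ 1 / Real.pi := by
    rw [le_div_iff₀ (by linarith)]
    linarith
  simp only [hF]
  norm_num at l1 l1' l2 l3 l4 ⊢
  linarith

lemma continuousOn_mul_wt : ContinuousOn (fun y => y * wt y) (Ici 0) := by
  have h1 : ContinuousOn (fun y : ℝ => Real.sqrt (y ^ 2 * Real.log (1 + y) - y * (y * Real.log y)))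
      (Ici 0) := by
    refine ContinuousOn.sqrt (ContinuousOn.sub ?_ ?_)
    · refine (continuous_pow 2).continuousOn.mul (ContinuousOn.log (by fun_prop) ?_)
      intro y hy
      have : (0 : ℝ) ≤ y := hy
      positivity
    · exact (continuous_id.mul Real.continuous_mul_log).continuousOn
  refine h1.congr fun y hy => ?_
  rcases (mem_Ici.1 hy).eq_or_lt with rfl | hy
  · simp
  · simp only [wt]
    rw [show y ^ 2 * Real.log (1 + y) - y * (y * Real.log y) = y ^ 2 * Real.log (1 + 1 / y) by
      rw [show 1 + 1 / y = (1 + y) / y by field_simp; ring,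
        Real.log_div (by positivity) hy.ne']
      ring, Real.sqrt_mul (by positivity), Real.sqrt_sq hy.le]

lemma continuous_kerGap : Continuous kerGap := by
  unfold kerGap
  fun_prop

lemma le_integral_kerGap : 0.1142 ≤ ∫ y in (0 : ℝ)..Real.pi, kerGap y * (y * wt y) := by
  have hp := Real.pi_gt_d4
  have hp' := Real.pi_lt_d4
  have hp0 : Real.pi ≠ 0 := Real.pi_ne_zero
  have h0 : (0 : ℝ) ≤ Real.pi := by linarith
  set p := Real.pi with hpdef
  have hd : ∀ y : ℝ, HasDerivAt (fun y : ℝ =>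
      25 / 27 * (3 / 10 * y ^ 2 / p ^ 2 - 7 / 80 * y ^ 4 / p ^ 4 - 1 / 24 * y ^ 6 / p ^ 6) -
      4 / 27 * (1 / 5 * y ^ 3 / p ^ 2 - 7 / 100 * y ^ 5 / p ^ 4 - 1 / 28 * y ^ 7 / p ^ 6))
      (kerGap y * (y * (25 / 27 - 4 / 27 * y))) y := by
    intro y
    have d := fun (c e : ℝ) (n : ℕ) => ((hasDerivAt_pow n y).const_mul c).div_const e
    refine (((((d (3 / 10) (p ^ 2) 2).sub (d (7 / 80) (p ^ 4) 4)).sub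
      (d (1 / 24) (p ^ 6) 6)).const_mul (25 / 27)).sub
      ((((d (1 / 5) (p ^ 2) 3).sub (d (7 / 100) (p ^ 4) 5)).sub
      (d (1 / 28) (p ^ 6) 7)).const_mul (4 / 27))).congr_deriv ?_
    rw [kerGap, ← hpdef]
    field_simp
    push_cast
    ring
  have hci : Continuous fun y : ℝ => kerGap y * (y * (25 / 27 - 4 / 27 * y)) := by
    have := continuous_kerGap
    fun_prop
  have hle := intervalIntegral.integral_mono_on (f := fun y : ℝ =>
    kerGap y * (y * (25 / 27 - 4 / 27 * y))) (g := fun y => kerGap y * (y * wt y)) h0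
    (hci.intervalIntegrable (μ := MeasureTheory.volume) 0 p)
    ((continuous_kerGap.continuousOn.mul (continuousOn_mul_wt.mono
      Icc_subset_Ici_self)).intervalIntegrable_of_Icc h0) fun y hy => by
    have hg : 0 ≤ kerGap y := by
      have : y ^ 2 / p ^ 2 ≤ 1 := by
        rw [div_le_one (by positivity)]
        exact pow_le_pow_left₀ hy.1 hy.2 2
      have : 0 ≤ 1 - y ^ 2 / p ^ 2 := by linarith
      rw [kerGap, ← hpdef]
      positivity
    rcases hy.1.eq_or_lt with rfl | hy0
    · simp
    · have := tangent_le_wt hy0 (by linarith [hy.2])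
      gcongr
  rw [intervalIntegral.integral_eq_sub_of_hasDerivAt (fun y _ => hd y)
    (hci.intervalIntegrable _ _)] at hle
  refine le_trans ?_ hle
  have e : 25 / 27 * (3 / 10 * p ^ 2 / p ^ 2 - 7 / 80 * p ^ 4 / p ^ 4 - 1 / 24 * p ^ 6 / p ^ 6) -
      4 / 27 * (1 / 5 * p ^ 3 / p ^ 2 - 7 / 100 * p ^ 5 / p ^ 4 - 1 / 28 * p ^ 7 / p ^ 6) =
      25 / 27 * (41 / 240) - 4 / 27 * (33 / 350) * p := by
    field_simp
    ring
  rw [e]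
  norm_num at hp' ⊢
  linarith

/-- The expression `-log (1 - x² / y²)`, expanded. -/
noncomputable def singKer (x y : ℝ) : ℝ :=
  2 * Real.log y - Real.log (y - x) - Real.log (y + x)

lemma singKer_eq {x y : ℝ} (hx : 0 < x) (hxy : x < y) :
    singKer x y = -Real.log (1 - x ^ 2 / y ^ 2) := by
  have hy : 0 < y := hx.trans hxy
  have h1 : 0 < y - x := by linarith
  rw [show 1 - x ^ 2 / y ^ 2 = (y - x) * (y + x) / y ^ 2 by field_simp; ring,
    Real.log_div (by positivity) (by positivity), Real.log_mul (by positivity) (by positivity),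
    Real.log_pow, singKer]
  push_cast
  ring

lemma div_sq_le_singKer {x y : ℝ} (hx : 0 < x) (hxy : x < y) :
    x ^ 2 / y ^ 2 ≤ singKer x y := by
  have hy : 0 < y := hx.trans hxy
  rw [singKer_eq hx hxy]
  have h : 0 < 1 - x ^ 2 / y ^ 2 := by
    rw [sub_pos, div_lt_one (by positivity)]
    gcongr
  linarith [Real.log_le_sub_one_of_pos h]

lemma intervalIntegrable_singKer (x a b : ℝ) :
    IntervalIntegrable (singKer x) MeasureTheory.volume a b := by
  have h1 : IntervalIntegrable (fun y => Real.log (y - x)) MeasureTheory.volume a b := by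
    have := (intervalIntegral.intervalIntegrable_log' (a := a - x) (b := b - x)).comp_sub_right x
    simpa using this
  have h2 : IntervalIntegrable (fun y => Real.log (y + x)) MeasureTheory.volume a b := by
    have := (intervalIntegral.intervalIntegrable_log' (a := a + x) (b := b + x)).comp_add_right x
    simpa using this
  exact ((intervalIntegral.intervalIntegrable_log'.const_mul 2).sub h1).sub h2

/-- An antiderivative of `singKer x y * (α * y + β * (y - x) + γ * (y - x) ^ 2)`. -/
noncomputable def singPrim (x α β γ y : ℝ) : ℝ :=
  α * (y ^ 2 * Real.log y - (y + x) / 2 * ((y - x) * Real.log (y - x)) -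
    (y - x) * (y + x) / 2 * Real.log (y + x)) +
  β * ((y - x) ^ 2 / 2 * (2 * Real.log y - Real.log (y + x)) -
    (y - x) / 2 * ((y - x) * Real.log (y - x)) + x ^ 2 * (2 * Real.log (y + x) - Real.log y)) +
  γ * ((y - x) ^ 3 / 3 * (2 * Real.log y - Real.log (y + x)) -
    (y - x) ^ 2 / 3 * ((y - x) * Real.log (y - x)) +
    2 / 3 * x ^ 2 * (y + x * Real.log y - 4 * x * Real.log (y + x)))

lemma integral_singKer_mul {x a b : ℝ} (α β γ : ℝ) (hx : 0 < x) (ha : x ≤ a) (hab : a ≤ b) :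
    ∫ y in a..b, singKer x y * (α * y + β * (y - x) + γ * (y - x) ^ 2) =
      singPrim x α β γ b - singPrim x α β γ a := by
  refine intervalIntegral.integral_eq_sub_of_hasDerivAt_of_le hab ?_ ?_ ?_
  · have hc : Continuous fun y => (y - x) * Real.log (y - x) :=
      Real.continuous_mul_log.comp (continuous_id.sub continuous_const)
    intro y hy
    have hy0 : 0 < y := by linarith [hy.1]
    have c1 : ContinuousAt (fun y => Real.log y) y := Real.continuousAt_log hy0.ne'
    have c2 : ContinuousAt (fun y => Real.log (y + x)) y :=
      ContinuousAt.log (by fun_prop) (by positivity)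
    have c3 := hc.continuousAt (x := y)
    have p1 : ContinuousAt (fun y : ℝ => y ^ 2) y := by fun_prop
    have p2 : ContinuousAt (fun y : ℝ => (y + x) / 2) y := by fun_prop
    have p3 : ContinuousAt (fun y : ℝ => (y - x) * (y + x) / 2) y := by fun_prop
    have p4 : ContinuousAt (fun y : ℝ => (y - x) ^ 2 / 2) y := by fun_prop
    have p5 : ContinuousAt (fun y : ℝ => (y - x) / 2) y := by fun_prop
    have p6 : ContinuousAt (fun y : ℝ => (y - x) ^ 3 / 3) y := by fun_prop
    have p7 : ContinuousAt (fun y : ℝ => (y - x) ^ 2 / 3) y := by fun_prop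
    have k : ∀ c : ℝ, ContinuousAt (fun _ : ℝ => c) y := fun c => continuousAt_const
    have c4 := ((k 2).mul c1).sub c2
    have t1 := (k α).mul (((p1.mul c1).sub (p2.mul c3)).sub (p3.mul c2))
    have t2 := (k β).mul (((p4.mul c4).sub (p5.mul c3)).add
      ((k (x ^ 2)).mul (((k 2).mul c2).sub c1)))
    have t3 := (k γ).mul (((p6.mul c4).sub (p7.mul c3)).add
      ((k (2 / 3 * x ^ 2)).mul ((continuousAt_id.add ((k x).mul c1)).sub ((k (4 * x)).mul c2))))
    exact ((t1.add t2).add t3).continuousWithinAt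
  · intro y hy
    have hy0 : 0 < y := by linarith [hy.1]
    have hyx : 0 < y - x := by linarith [hy.1]
    have hyx' : 0 < y + x := by linarith
    have i := hasDerivAt_id y
    have l1 : HasDerivAt (fun y => Real.log y) (1 / y) y := i.log hy0.ne'
    have l2 : HasDerivAt (fun y => Real.log (y + x)) (1 / (y + x)) y :=
      (i.add_const x).log hyx'.ne'
    have l3 : HasDerivAt (fun y => Real.log (y - x)) (1 / (y - x)) y :=
      (i.sub_const x).log hyx.ne'
    have s : HasDerivAt (fun y : ℝ => y - x) 1 y := i.sub_const x
    have s' : HasDerivAt (fun y : ℝ => y + x) 1 y := i.add_const x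
    have l4 := s.mul l3
    have l5 := (l1.const_mul 2).sub l2
    have t1 := ((((i.pow 2).mul l1).sub ((s'.div_const 2).mul l4)).sub
      (((s.mul s').div_const 2).mul l2)).const_mul α
    have t2 := (((((s.pow 2).div_const 2).mul l5).sub ((s.div_const 2).mul l4)).add
      (((l2.const_mul 2).sub l1).const_mul (x ^ 2))).const_mul β
    have t3 := (((((s.pow 3).div_const 3).mul l5).sub (((s.pow 2).div_const 3).mul l4)).add
      (((i.add (l1.const_mul x)).sub (l2.const_mul (4 * x))).const_mul
        (2 / 3 * x ^ 2))).const_mul γ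
    refine ((t1.add t2).add t3).congr_deriv ?_
    simp only [singKer, id, Pi.pow_apply, Pi.mul_apply, Pi.sub_apply]
    field_simp
    ring
  · refine (intervalIntegrable_singKer x a b).mul_continuousOn ?_
    fun_prop

lemma intervalIntegrable_singKer_mul_wt {x a b : ℝ} (ha : 0 ≤ a) (hab : a ≤ b) :
    IntervalIntegrable (fun y => singKer x y * (y * wt y)) MeasureTheory.volume a b :=
  (intervalIntegrable_singKer x a b).mul_continuousOn <| continuousOn_mul_wt.mono fun y hy => by
    rw [uIcc_of_le hab] at hy
    exact ha.trans hy.1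

lemma singKer_nonneg {x y : ℝ} (hx : 0 < x) (hxy : x < y) : 0 ≤ singKer x y :=
  (by positivity : 0 ≤ x ^ 2 / y ^ 2).trans (div_sq_le_singKer hx hxy)

lemma integral_singKer_mul_wt_near_le {x : ℝ} (hx : 0 < x) (hx1 : x ≤ 1 / 2) :
    ∫ y in x..2 * x, singKer x y * (y * wt y) ≤
      x ^ 2 * (wt x * (4 * Real.log 2 - 3 / 2 * Real.log 3) -
        (Real.log 3 - 4 / 3 * Real.log 2 + 1 / 9) / (2 * wt x * (1 + x))) := by
  have hw := wt_pos hx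
  set β : ℝ := -(1 / (2 * wt x * (1 + x))) with hβ
  have h := intervalIntegral.integral_mono_on_of_le_Ioo (a := x) (b := 2 * x) (by linarith)
    (intervalIntegrable_singKer_mul_wt (x := x) hx.le (by linarith))
    ((intervalIntegrable_singKer x x (2 * x)).mul_continuousOn
      (g := fun y => wt x * y + β * (y - x) + β / (6 * x) * (y - x) ^ 2) (by fun_prop))
    (fun y hy => by
      refine mul_le_mul_of_nonneg_left ?_ (singKer_nonneg hx hy.1)
      refine (wt_sub_ge hx hx1 hy.1.le hy.2.le).trans_eq ?_
      rw [hβ]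
      field_simp
      ring)
  rw [integral_singKer_mul _ _ _ hx le_rfl (by linarith)] at h
  refine h.trans_eq ?_
  simp only [singPrim]
  have e1 : Real.log (2 * x) = Real.log 2 + Real.log x := Real.log_mul (by norm_num) hx.ne'
  have e2 : Real.log (3 * x) = Real.log 3 + Real.log x := Real.log_mul (by norm_num) hx.ne'
  rw [show 2 * x - x = x by ring, show 2 * x + x = 3 * x by ring, show x + x = 2 * x by ring,
    sub_self, e1, e2, hβ]
  field_simp
  ring

lemma integral_wt_div_le_of_le_one {a b : ℝ} (ha : 0 < a) (hab : a ≤ b) (hb : b ≤ 1) :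
    ∫ y in a..b, wt y / y ≤
      (2 / 3 * (Real.log (1 / a) * √(Real.log (1 / a))) + √(Real.log 2) * Real.log (1 / a)) -
      (2 / 3 * (Real.log (1 / b) * √(Real.log (1 / b))) + √(Real.log 2) * Real.log (1 / b)) := by
  have hpos : ∀ y ∈ Icc a b, 0 < y := fun y hy => ha.trans_le hy.1
  set f : ℝ → ℝ := fun y => (√(Real.log (1 / y)) + √(Real.log 2)) / y with hf
  have hlc : ∀ y, 0 < y → ContinuousAt (fun y => Real.log (1 / y)) y := fun y hy =>
    (continuousAt_const.div continuousAt_id hy.ne').log (one_div_pos.2 hy).ne'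
  have hfi : IntervalIntegrable f MeasureTheory.volume a b := by
    refine ContinuousOn.intervalIntegrable_of_Icc hab fun y hy => ?_
    exact ((((hlc y (hpos y hy)).sqrt).add continuousAt_const).div continuousAt_id
      (hpos y hy).ne').continuousWithinAt
  have hwi : IntervalIntegrable (fun y => wt y / y) MeasureTheory.volume a b :=
    ((continuousOn_wt.mono hpos).div continuousOn_id fun y hy =>
      (hpos y hy).ne').intervalIntegrable_of_Icc hab
  refine (intervalIntegral.integral_mono_on hab hwi hfi fun y hy => ?_).trans_eq ?_
  · have := hpos y hy
    simp only [hf]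
    gcongr
    exact wt_le_sqrt_add_sqrt this (hy.2.trans hb)
  · rw [intervalIntegral.integral_eq_sub_of_hasDerivAt_of_le hab (f := fun y =>
      -(2 / 3 * (Real.log (1 / y) * √(Real.log (1 / y))) + √(Real.log 2) * Real.log (1 / y)))
      (fun y hy => ?_) (fun y hy => ?_) hfi]
    · ring
    · have c := hlc y (hpos y hy)
      exact (((c.mul c.sqrt).const_mul (2 / 3)).add
        (c.const_mul (√(Real.log 2)))).neg.continuousWithinAt
    · have hy0 : 0 < y := ha.trans hy.1
      have hl : 0 < Real.log (1 / y) := Real.log_pos (by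
        rw [lt_div_iff₀ hy0]; linarith [hy.2])
      have d : HasDerivAt (fun y => Real.log (1 / y)) (-(1 / y)) y := by
        simp only [one_div, Real.log_inv]
        exact (Real.hasDerivAt_log hy0.ne').fun_neg
      refine (((d.mul (d.sqrt hl.ne')).const_mul (2 / 3)).add
        (d.const_mul (√(Real.log 2)))).neg.congr_deriv ?_
      have hs := Real.sqrt_pos.2 hl
      have hs2 := Real.sq_sqrt hl.le
      simp only [hf]
      generalize Real.log (1 / y) = l at *
      field_simp
      linear_combination -hs2

lemma integral_wt_div_le_sub {a : ℝ} (ha : 0 < a) (ha1 : a ≤ 0.7) :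
    ∫ y in a..1, wt y / y ≤
      2 / 3 * (Real.log (1 / a) * √(Real.log (1 / a))) + √(Real.log 2) * Real.log (1 / a)
        - 0.1 := by
  have hq := sqrt_log_two_bounds
  have hq2 := Real.sq_sqrt (x := Real.log 2) (by positivity)
  set s := √(Real.log 2) with hs
  have hi : ∀ b c : ℝ, 0 < b → b ≤ c →
      IntervalIntegrable (fun y => wt y / y) MeasureTheory.volume b c := fun b c hb hbc => by
    have hpos : ∀ y ∈ Icc b c, 0 < y := fun y hy => hb.trans_le hy.1
    exact ((continuousOn_wt.mono hpos).div continuousOn_id fun y hy =>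
      (hpos y hy).ne').intervalIntegrable_of_Icc hbc
  rw [← intervalIntegral.integral_add_adjacent_intervals (hi a 0.7 ha ha1)
    (hi 0.7 1 (by norm_num) (by norm_num))]
  have h1 := integral_wt_div_le_of_le_one ha ha1 (by norm_num)
  set l := Real.log (1 / 0.7) with hl
  have h2 : ∫ y in (0.7 : ℝ)..1, wt y / y ≤ s * l + l ^ 2 / (4 * s) := by
    have hpos : ∀ y ∈ Icc (0.7 : ℝ) 1, 0 < y := fun y hy => by linarith [hy.1]
    set f : ℝ → ℝ := fun y => (s - Real.log y / (2 * s)) / y with hf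
    have hfi : IntervalIntegrable f MeasureTheory.volume 0.7 1 := by
      refine ContinuousOn.intervalIntegrable_of_Icc (by norm_num) fun y hy => ?_
      exact ((continuousAt_const.sub ((Real.continuousAt_log (hpos y hy).ne').div_const _)).div
        continuousAt_id (hpos y hy).ne').continuousWithinAt
    refine (intervalIntegral.integral_mono_on (by norm_num) (hi _ _ (by norm_num) (by norm_num)) hfi
      fun y hy => ?_).trans_eq ?_
    · have := hpos y hy
      simp only [hf]
      gcongr
      refine (wt_le_of_pos this hy.2 (p := s) (by linarith)).trans_eq ?_
      rw [← hq2, one_div, Real.log_inv]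
      have : s ≠ 0 := by linarith
      field_simp
      ring
    · rw [intervalIntegral.integral_eq_sub_of_hasDerivAt (f := fun y =>
        s * Real.log y - Real.log y ^ 2 / (4 * s)) (fun y hy => ?_) hfi]
      · rw [hl, one_div, Real.log_inv, Real.log_one]
        ring
      · rw [uIcc_of_le (by norm_num)] at hy
        have hy0 := hpos y hy
        have d := Real.hasDerivAt_log hy0.ne'
        refine ((d.const_mul s).sub ((d.pow 2).div_const (4 * s))).congr_deriv ?_
        have : s ≠ 0 := by linarith
        simp only [hf]
        field_simp
        ring
  have hl1 : 6 / 17 ≤ l := by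
    have := Real.le_log_one_add_of_nonneg (x := 3 / 7) (by norm_num)
    norm_num at this hl
    rw [hl]; exact this
  have hl2 : l ≤ 0.35715 := by
    have := log_one_add_le_pade (u := 3 / 7) (by norm_num)
    norm_num at this hl ⊢
    rw [hl]; linarith
  have hr : 0.594 ≤ √l := Real.le_sqrt_of_sq_le (by norm_num at hl1 ⊢; linarith)
  have h3 : l ^ 2 / (4 * s) ≤ 0.0384 := by
    rw [div_le_iff₀ (by linarith)]
    norm_num at hl2 hq ⊢
    nlinarith
  have h4 : 6 / 17 * 0.594 ≤ l * √l := by gcongr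
  norm_num at h1 h2 h3 h4 ⊢
  linarith

lemma intervalIntegrable_wt_div_pow (n : ℕ) {a b : ℝ} (ha : 0 < a) (hab : a ≤ b) :
    IntervalIntegrable (fun y => wt y / y ^ n) MeasureTheory.volume a b := by
  have hpos : ∀ y ∈ Icc a b, 0 < y := fun y hy => ha.trans_le hy.1
  exact ((continuousOn_wt.mono hpos).div (continuousOn_id.pow n) fun y hy =>
      pow_ne_zero n (hpos y hy).ne').intervalIntegrable_of_Icc hab

lemma integral_wt_div_cube_le_of_pos {a p : ℝ} (ha : 0 < a) (ha1 : a ≤ 1) (hp : 0 < p) :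
    ∫ y in a..1, wt y / y ^ 3 ≤
      ((Real.log (1 / a) - (1 - a ^ 2) / 2 + Real.log 2 * (1 - a ^ 2)) / p + p * (1 - a ^ 2)) /
        (4 * a ^ 2) := by
  have hpos : ∀ y ∈ Icc a 1, 0 < y := fun y hy => ha.trans_le hy.1
  set f : ℝ → ℝ := fun y => ((-Real.log y + Real.log 2) / p + p) / 2 / y ^ 3 with hf
  have hfi : IntervalIntegrable f MeasureTheory.volume a 1 := by
    refine ContinuousOn.intervalIntegrable_of_Icc ha1 fun y hy => ?_
    exact ((((((Real.continuousAt_log (hpos y hy).ne').neg.add continuousAt_const).div_const _).add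
      continuousAt_const).div_const _).div (continuousAt_id.pow 3)
        (pow_ne_zero 3 (hpos y hy).ne')).continuousWithinAt
  refine (intervalIntegral.integral_mono_on ha1 (intervalIntegrable_wt_div_pow 3 ha ha1) hfi
    fun y hy => ?_).trans_eq ?_
  · have := hpos y hy
    simp only [hf]
    gcongr
    refine (wt_le_of_pos this hy.2 hp).trans_eq ?_
    rw [one_div, Real.log_inv]
  · rw [intervalIntegral.integral_eq_sub_of_hasDerivAt (f := fun y =>
      ((Real.log y / (2 * y ^ 2) + 1 / (4 * y ^ 2) - Real.log 2 / (2 * y ^ 2)) / p -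
        p / (2 * y ^ 2)) / 2) (fun y hy => ?_) hfi]
    · rw [one_div a, Real.log_inv, Real.log_one]
      field_simp
      ring
    · rw [uIcc_of_le ha1] at hy
      have hy0 := hpos y hy
      have d := Real.hasDerivAt_log hy0.ne'
      have e : ∀ c : ℝ, HasDerivAt (fun y : ℝ => c * y ^ 2) (c * (2 * y)) y := fun c => by
        simpa using (hasDerivAt_pow 2 y).const_mul c
      have k : ∀ c : ℝ, HasDerivAt (fun _ : ℝ => c) 0 y := fun c => hasDerivAt_const y c
      have n2 : (2 : ℝ) * y ^ 2 ≠ 0 := by positivity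
      have n4 : (4 : ℝ) * y ^ 2 ≠ 0 := by positivity
      refine (((((d.div (e 2) n2).add ((k 1).div (e 4) n4)).sub
        ((k (Real.log 2)).div (e 2) n2)).div_const p).sub
          ((k p).div (e 2) n2)).div_const 2 |>.congr_deriv ?_
      simp only [hf]
      field_simp
      ring

lemma integral_wt_div_cube_le {a : ℝ} (ha : 0 < a) (ha1 : a < 1) :
    ∫ y in a..1, wt y / y ^ 3 ≤
      (√(Real.log (1 / a)) - (1 - a ^ 2) / (2 * √(Real.log (1 / a))) +
        √(Real.log 2) * (1 - a ^ 2)) / (2 * a ^ 2) := by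
  have hL : 0 < Real.log (1 / a) := Real.log_pos (by rwa [lt_div_iff₀ ha, one_mul])
  have hr2 := Real.sq_sqrt hL.le
  have hr := Real.sqrt_pos.2 hL
  have hs2 := Real.sq_sqrt (x := Real.log 2) (by positivity)
  have hs := sqrt_log_two_bounds.1
  have hs0 : 0 < √(Real.log 2) := by linarith
  have hP : 1 - a ^ 2 ≤ 2 * Real.log (1 / a) := by
    have := Real.log_le_sub_one_of_pos (show 0 < a ^ 2 by positivity)
    rw [Real.log_pow] at this
    rw [one_div, Real.log_inv]
    push_cast at this
    linarith
  have hP0 : 0 < 1 - a ^ 2 := by nlinarith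
  have hP1 : 1 - a ^ 2 ≤ 1 := by nlinarith
  have h := fun p hp => integral_wt_div_cube_le_of_pos (p := p) ha ha1.le hp
  rw [← hr2] at hP
  rw [← hr2, ← hs2] at h
  set r := √(Real.log (1 / a))
  set s := √(Real.log 2)
  set P := 1 - a ^ 2 with hPd
  rw [show (4 : ℝ) * a ^ 2 = 2 * (2 * a ^ 2) by ring] at h
  rcases le_total r (2 * s) with hc | hc
  · refine (h s hs0).trans ?_
    rw [← div_div]
    gcongr
    have h1 : (r ^ 2 - P / 2) / (2 * s) ≤ (r ^ 2 - P / 2) / r := by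
      gcongr
      linarith
    have e1 : ((r ^ 2 - P / 2 + s ^ 2 * P) / s + s * P) / 2 = (r ^ 2 - P / 2) / (2 * s) + s * P := by
      field_simp
      ring
    have e2 : r - P / (2 * r) + s * P = (r ^ 2 - P / 2) / r + s * P := by
      field_simp
    linarith
  · refine (h r hr).trans ?_
    rw [← div_div]
    gcongr
    rw [← sub_nonneg]
    have e : r - P / (2 * r) + s * P - ((r ^ 2 - P / 2 + s ^ 2 * P) / r + r * P) / 2 =
        (r ^ 2 * (1 - P) + P * (2 * r * s - s ^ 2 - 1 / 2)) / (2 * r) := by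
      field_simp
      ring
    rw [e]
    have : 0 ≤ 2 * r * s - s ^ 2 - 1 / 2 := by nlinarith
    have : 0 ≤ 1 - P := by linarith
    positivity

lemma integral_singKer_mul_wt_mid_le {x R : ℝ} (hx : 0 < x) (hx1 : x < 1 / 2)
    (hR : ∀ y ∈ Icc (0 : ℝ) (1 / 4), -Real.log (1 - y) ≤ y + R * y ^ 2) :
    ∫ y in 2 * x..1, singKer x y * (y * wt y) ≤
      x ^ 2 * (∫ y in 2 * x..1, wt y / y) + R * x ^ 4 * ∫ y in 2 * x..1, wt y / y ^ 3 := by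
  have h2x : (0 : ℝ) < 2 * x := by linarith
  have h21 : 2 * x ≤ 1 := by linarith
  have i1 := (intervalIntegrable_wt_div_pow 1 h2x h21).const_mul (x ^ 2)
  have i3 := (intervalIntegrable_wt_div_pow 3 h2x h21).const_mul (R * x ^ 4)
  simp only [pow_one] at i1
  rw [← intervalIntegral.integral_const_mul, ← intervalIntegral.integral_const_mul,
    ← intervalIntegral.integral_add i1 i3]
  refine intervalIntegral.integral_mono_on h21 (intervalIntegrable_singKer_mul_wt h2x.le h21)
    (i1.add i3) fun y hy => ?_
  have hy0 : 0 < y := h2x.trans_le hy.1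
  have hb : x ^ 2 / y ^ 2 ≤ 1 / 4 := by
    rw [div_le_iff₀ (by positivity)]
    nlinarith [hy.1]
  have := hR _ ⟨by positivity, hb⟩
  rw [← singKer_eq hx (by linarith [hy.1])] at this
  refine (mul_le_mul_of_nonneg_right this (mul_nonneg hy0.le (wt_nonneg y))).trans_eq ?_
  field_simp

lemma integral_singKer_mul_wt_far_le {x : ℝ} (hx : 0 < x) (hx1 : x < 1) :
    ∫ y in 1..Real.pi, singKer x y * (y * wt y) ≤
      √(Real.log 2) * (Real.pi ^ 2 * Real.log Real.pi -
        (Real.pi ^ 2 - x ^ 2) / 2 * Real.log (Real.pi ^ 2 - x ^ 2) +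
        (1 - x ^ 2) / 2 * Real.log (1 - x ^ 2)) +
      x ^ 2 * ((∫ y in 1..Real.pi, wt y / y) - √(Real.log 2) * Real.log Real.pi) := by
  have h1p : (1 : ℝ) ≤ Real.pi := by linarith [Real.pi_gt_three]
  have i1 := (intervalIntegrable_wt_div_pow 1 one_pos h1p).const_mul (x ^ 2)
  simp only [pow_one] at i1
  have hinv : IntervalIntegrable (fun y : ℝ => 1 / y) MeasureTheory.volume 1 Real.pi := by
    refine ContinuousOn.intervalIntegrable_of_Icc h1p fun y hy => ?_
    have : y ≠ 0 := by linarith [hy.1]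
    exact (continuousAt_const.div continuousAt_id this).continuousWithinAt
  have i2 := hinv.const_mul (x ^ 2 * √(Real.log 2))
  have i0 : IntervalIntegrable (fun y => singKer x y * (√(Real.log 2) * y + 0 * (y - x) +
      0 * (y - x) ^ 2)) MeasureTheory.volume 1 Real.pi :=
    (intervalIntegrable_singKer x _ _).mul_continuousOn (by fun_prop)
  have h := intervalIntegral.integral_mono_on h1p
    (intervalIntegrable_singKer_mul_wt (x := x) zero_le_one h1p) ((i0.add i1).sub i2)
    (fun y hy => by
      have hy0 : 0 < y := by linarith [hy.1]
      have h1 := div_sq_le_singKer hx (y := y) (by linarith [hy.1])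
      have h2 := wt_le_wt one_pos hy.1
      rw [wt_one] at h2
      have h3 := mul_le_mul_of_nonneg_right h1
        (mul_nonneg hy0.le (sub_nonneg.2 h2))
      have e : x ^ 2 / y ^ 2 * (y * (√(Real.log 2) - wt y)) =
        x ^ 2 * √(Real.log 2) * (1 / y) - x ^ 2 * (wt y / y) := by
          field_simp
      rw [e] at h3
      linarith)
  rw [intervalIntegral.integral_sub (i0.add i1) i2, intervalIntegral.integral_add i0 i1,
    integral_singKer_mul _ _ _ hx hx1.le h1p, intervalIntegral.integral_const_mul,
    intervalIntegral.integral_const_mul, integral_one_div_of_pos one_pos Real.pi_pos] at h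
  refine h.trans_eq ?_
  have e1 : Real.log (Real.pi ^ 2 - x ^ 2) = Real.log (Real.pi - x) + Real.log (Real.pi + x) := by
    rw [← Real.log_mul (by linarith) (by linarith)]
    ring_nf
  have e2 : Real.log (1 - x ^ 2) = Real.log (1 - x) + Real.log (1 + x) := by
    rw [← Real.log_mul (by linarith) (by linarith)]
    ring_nf
  rw [e1, e2, div_one]
  simp only [singPrim, Real.log_one]
  ring

lemma U₂_le {x D : ℝ} (hx : 0 < x) (hx1 : x < 1 / 2)
    (hD : -Real.log (kerRatio x Real.pi) ≤ D * x ^ 2) :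
    U₂ x ≤ (∫ y in x..Real.pi, singKer x y * (y * wt y)) + x ^ 2 * (D * c₂ - 0.1142) := by
  have hp := Real.pi_gt_three
  have hxp : x ≤ Real.pi := by linarith
  have hgap : ∀ y ∈ Icc 0 Real.pi, kerGap y ≤ D := fun y hy => by
    have := sq_mul_kerGap_le hx hx1 hy.1 hy.2
    nlinarith [sq_pos_of_pos hx]
  have hcw : ∀ a b : ℝ, 0 ≤ a → a ≤ b → ContinuousOn (fun y => y * wt y) (uIcc a b) :=
    fun a b ha hab => continuousOn_mul_wt.mono fun y hy => by
      rw [uIcc_of_le hab] at hy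
      exact ha.trans hy.1
  have hcg : ∀ a b : ℝ, 0 ≤ a → a ≤ b → IntervalIntegrable (fun y => kerGap y * (y * wt y))
      MeasureTheory.volume a b := fun a b ha hab =>
    (continuous_kerGap.continuousOn.mul (hcw a b ha hab)).intervalIntegrable
  have hcd : ∀ a b : ℝ, 0 ≤ a → a ≤ b → IntervalIntegrable (fun y => (D - kerGap y) * (y * wt y))
      MeasureTheory.volume a b := fun a b ha hab =>
    ((continuousOn_const.sub continuous_kerGap.continuousOn).mul
      (hcw a b ha hab)).intervalIntegrable
  have hs := intervalIntegrable_singKer_mul_wt (x := x) hx.le hxp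
  have hreg : ∫ y in x..Real.pi, (D - kerGap y) * (y * wt y) ≤ D * c₂ - 0.1142 := by
    have h1 : ∫ y in x..Real.pi, (D - kerGap y) * (y * wt y) ≤
        ∫ y in 0..Real.pi, (D - kerGap y) * (y * wt y) := by
      rw [← intervalIntegral.integral_add_adjacent_intervals (hcd 0 x le_rfl hx.le)
        (hcd x _ hx.le hxp)]
      refine le_add_of_nonneg_left (intervalIntegral.integral_nonneg hx.le fun y hy => ?_)
      exact mul_nonneg (sub_nonneg.2 (hgap y ⟨hy.1, hy.2.trans hxp⟩))
        (mul_nonneg hy.1 (wt_nonneg y))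
    have h2 : ∫ y in 0..Real.pi, (D - kerGap y) * (y * wt y) =
        D * c₂ - ∫ y in 0..Real.pi, kerGap y * (y * wt y) := by
      rw [show c₂ = ∫ y in 0..Real.pi, y * wt y from rfl,
        ← intervalIntegral.integral_const_mul, ← intervalIntegral.integral_sub
        ((hcw 0 _ le_rfl Real.pi_pos.le).intervalIntegrable.const_mul D)
        (hcg 0 _ le_rfl Real.pi_pos.le)]
      exact intervalIntegral.integral_congr fun y _ => sub_mul _ _ _
    have := le_integral_kerGap
    linarith
  have hmain : U₂ x ≤ ∫ y in x..Real.pi,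
      (singKer x y * (y * wt y) + x ^ 2 * ((D - kerGap y) * (y * wt y))) := by
    rw [U₂, ← intervalIntegral.integral_neg, intervalIntegral.integral_of_le hxp,
      intervalIntegral.integral_of_le hxp]
    refine MeasureTheory.integral_mono_of_nonneg ?_
      (hs.add ((hcd x _ hx.le hxp).const_mul (x ^ 2))).1 ?_
    · filter_upwards [MeasureTheory.ae_restrict_mem measurableSet_Ioc] with y hy
      have := mul_nonneg (neg_nonneg.2 (Iker_nonpos hx hy.1 hy.2))
        (mul_nonneg (hx.trans hy.1).le (wt_nonneg y))
      simpa [wt] using this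
    · filter_upwards [MeasureTheory.ae_restrict_mem measurableSet_Ioc] with y hy
      have h1 := neg_log_kerRatio_le hx hx1 hy.1 hy.2
      have h2 := Iker_eq hx hy.1 hy.2
      have h3 := singKer_eq hx hy.1
      have h4 : -Iker x y ≤ singKer x y + x ^ 2 * (D - kerGap y) := by linarith
      have := mul_le_mul_of_nonneg_right h4 (mul_nonneg (hx.trans hy.1).le (wt_nonneg y))
      change -(Iker x y * (y * wt y)) ≤ _
      linarith
  rw [intervalIntegral.integral_add hs ((hcd x _ hx.le hxp).const_mul (x ^ 2)),
    intervalIntegral.integral_const_mul] at hmain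
  refine hmain.trans ?_
  gcongr

lemma integral_singKer_mul_wt_le {x R : ℝ} (hx : 0 < x) (hx1 : x < 1 / 2)
    (hR : ∀ y ∈ Icc (0 : ℝ) (1 / 4), -Real.log (1 - y) ≤ y + R * y ^ 2) :
    ∫ y in x..Real.pi, singKer x y * (y * wt y) ≤
      x ^ 2 * (wt x * (4 * Real.log 2 - 3 / 2 * Real.log 3) -
        (Real.log 3 - 4 / 3 * Real.log 2 + 1 / 9) / (2 * wt x * (1 + x))) +
      (x ^ 2 * (∫ y in 2 * x..1, wt y / y) + R * x ^ 4 * ∫ y in 2 * x..1, wt y / y ^ 3) +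
      (√(Real.log 2) * (Real.pi ^ 2 * Real.log Real.pi -
        (Real.pi ^ 2 - x ^ 2) / 2 * Real.log (Real.pi ^ 2 - x ^ 2) +
        (1 - x ^ 2) / 2 * Real.log (1 - x ^ 2)) +
      x ^ 2 * (0.7715 - √(Real.log 2) * Real.log Real.pi)) := by
  have hp := Real.pi_gt_three
  have i1 := intervalIntegrable_singKer_mul_wt (x := x) hx.le (by linarith : x ≤ 2 * x)
  have i2 := intervalIntegrable_singKer_mul_wt (x := x) (by linarith) (by linarith : 2 * x ≤ 1)
  have i3 := intervalIntegrable_singKer_mul_wt (x := x) zero_le_one (by linarith : 1 ≤ Real.pi)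
  rw [← intervalIntegral.integral_add_adjacent_intervals (i1.trans i2) i3,
    ← intervalIntegral.integral_add_adjacent_intervals i1 i2]
  gcongr
  · exact integral_singKer_mul_wt_near_le hx hx1.le
  · exact integral_singKer_mul_wt_mid_le hx hx1 hR
  · refine (integral_singKer_mul_wt_far_le hx (by linarith)).trans ?_
    gcongr
    exact integral_wt_div_le

lemma wt_mul_one_add_le {x : ℝ} (hx : 0.35 ≤ x) (hx1 : x ≤ 1 / 2) : wt x * (1 + x) ≤ 1.58 := by
  have hx0 : 0 < x := by linarith
  have h : Real.log (1 + 1 / x) ≤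
      1.098613 + (1 - 2 * x) * (1 + 16 * x) / (3 * x * (4 + 10 * x)) := by
    have hu : 0 ≤ (1 - 2 * x) / (3 * x) := div_nonneg (by linarith) (by linarith)
    have e : 1 + 1 / x = 3 * (1 + (1 - 2 * x) / (3 * x)) := by
      field_simp
      ring
    rw [e, Real.log_mul (by norm_num) (by positivity)]
    have h1 := log_one_add_le_pade hu
    have e' : (1 - 2 * x) / (3 * x) * (6 + (1 - 2 * x) / (3 * x)) /
        (6 + 4 * ((1 - 2 * x) / (3 * x))) = (1 - 2 * x) * (1 + 16 * x) / (3 * x * (4 + 10 * x)) := by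
      have : 2 + 5 * x ≠ 0 := by positivity
      rw [show 6 + 4 * ((1 - 2 * x) / (3 * x)) = 2 * (2 + 5 * x) / (3 * x) by field_simp; ring]
      field_simp
      ring
    have h3 := Real.log_three_lt_d9
    norm_num at h3 ⊢
    linarith
  have hb : (1 + x) ^ 2 * Real.log (1 + 1 / x) ≤ 1.58 ^ 2 := by
    refine (mul_le_mul_of_nonneg_left h (by positivity)).trans ?_
    have : 0 < 3 * x * (4 + 10 * x) := by positivity
    rw [mul_add, ← mul_div_assoc, ← le_sub_iff_add_le', div_le_iff₀ this]
    norm_num at hx ⊢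
    have h0 := mul_nonneg (sub_nonneg.2 hx) (sub_nonneg.2 hx1)
    nlinarith [mul_nonneg h0 hx0.le, mul_nonneg h0 (sq_nonneg x)]
  have hw := wt_sq hx0
  have hw0 := wt_nonneg x
  refine (pow_le_pow_iff_left₀ (by positivity) (by norm_num) two_ne_zero).1 ?_
  rw [mul_pow, hw]
  linarith

lemma neg_log_one_sub_sq_div_pi_sq_le {x : ℝ} (hx : 0 < x) (hx1 : x < 1 / 2) :
    -Real.log (1 - x ^ 2 / Real.pi ^ 2) ≤ 1.0135 * (x ^ 2 / Real.pi ^ 2) := by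
  have hp := Real.pi_gt_d4
  set u := x ^ 2 / Real.pi ^ 2 with hu
  have hu0 : 0 ≤ u := by positivity
  have hu1 : u ≤ 0.02534 := by
    rw [hu, div_le_iff₀ (by positivity)]
    norm_num at hp ⊢
    nlinarith
  have h1u : 0 < 1 - u := by norm_num at hu1; linarith
  rw [← Real.log_inv, show (1 - u)⁻¹ = 1 + u / (1 - u) by field_simp; ring]
  refine (log_one_add_le_pade (by positivity)).trans ?_
  rw [show u / (1 - u) * (6 + u / (1 - u)) / (6 + 4 * (u / (1 - u))) =
    u * ((6 - 5 * u) / ((1 - u) * (6 - 2 * u))) by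
      have : 3 - u ≠ 0 := by norm_num at hu1; linarith
      rw [show 6 + 4 * (u / (1 - u)) = 2 * (3 - u) / (1 - u) by field_simp; ring,
        show 6 - 2 * u = 2 * (3 - u) by ring]
      field_simp
      ring, mul_comm]
  gcongr
  rw [div_le_iff₀ (by norm_num at hu1; nlinarith)]
  norm_num at hu1 ⊢
  nlinarith

lemma integral_wt_div_sub_near_le {x : ℝ} (hx : 0 < x) (hx1 : x < 1 / 2) :
    (∫ y in 2 * x..1, wt y / y) -
        (Real.log 3 - 4 / 3 * Real.log 2 + 1 / 9) / (2 * wt x * (1 + x)) ≤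
      2 / 3 * (Real.log (1 / (2 * x)) * √(Real.log (1 / (2 * x)))) +
        √(Real.log 2) * Real.log (1 / (2 * x)) - 0.09 := by
  have hw := wt_pos hx
  have h2 := log_two_bounds.2
  have h3 := Real.log_three_gt_d9
  have hK : 0.2855 ≤ Real.log 3 - 4 / 3 * Real.log 2 + 1 / 9 := by
    norm_num at h2 h3 ⊢
    linarith
  rcases le_total x 0.35 with hc | hc
  · have h := integral_wt_div_le_sub (a := 2 * x) (by linarith) (by norm_num at hc ⊢; linarith)
    have : 0 ≤ (Real.log 3 - 4 / 3 * Real.log 2 + 1 / 9) / (2 * wt x * (1 + x)) :=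
      div_nonneg (le_trans (by norm_num) hK) (by positivity)
    norm_num at h this ⊢
    linarith
  · have h := integral_wt_div_le_of_le_one (a := 2 * x) (by linarith) (by linarith) le_rfl
    have h' := wt_mul_one_add_le hc hx1.le
    have : 0.09 ≤ (Real.log 3 - 4 / 3 * Real.log 2 + 1 / 9) / (2 * wt x * (1 + x)) := by
      rw [le_div_iff₀ (by positivity)]
      norm_num at h' hK ⊢
      linarith
    norm_num at h this ⊢
    linarith

lemma sqrt_log_two_mul_le {x : ℝ} (hx : 0 < x) (hx1 : x < 1 / 2) :
    √(Real.log 2) * (-((Real.pi ^ 2 - 1) * Real.log (1 - x ^ 2 / Real.pi ^ 2) / (2 * x ^ 2)) -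
      Real.log Real.pi) ≤ -0.5673 := by
  have hp := Real.pi_gt_d4
  have hp' := Real.pi_lt_d4
  have hl := log_pi_gt
  have hs := sqrt_log_two_bounds
  have h := neg_log_one_sub_sq_div_pi_sq_le hx hx1
  have h1 : -((Real.pi ^ 2 - 1) * Real.log (1 - x ^ 2 / Real.pi ^ 2) / (2 * x ^ 2)) ≤ 0.45542 := by
    rw [← neg_div, ← mul_neg, div_le_iff₀ (by positivity)]
    refine (mul_le_mul_of_nonneg_left h (by nlinarith)).trans ?_
    rw [← mul_assoc, ← mul_div_assoc, div_le_iff₀ (by positivity)]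
    have : (Real.pi ^ 2 - 1) * 1.0135 ≤ 0.45542 * 2 * Real.pi ^ 2 := by
      norm_num at hp' ⊢
      nlinarith
    nlinarith [sq_nonneg x]
  norm_num at h1 hl hs ⊢
  nlinarith

lemma U₂_le_sq_mul {x R D : ℝ} (hx : 0 < x) (hx1 : x < 1 / 2) (hR0 : 0 ≤ R)
    (hR : ∀ y ∈ Icc (0 : ℝ) (1 / 4), -Real.log (1 - y) ≤ y + R * y ^ 2)
    (hD : -Real.log (kerRatio x Real.pi) ≤ D * x ^ 2) :
    U₂ x ≤ x ^ 2 * (wt x * (4 * Real.log 2 - 3 / 2 * Real.log 3) +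
      (2 / 3 * (Real.log (1 / (2 * x)) * √(Real.log (1 / (2 * x)))) +
        √(Real.log 2) * Real.log (1 / (2 * x))) +
      R * (√(Real.log (1 / (2 * x))) - (1 - (2 * x) ^ 2) / (2 * √(Real.log (1 / (2 * x)))) +
        √(Real.log 2) * (1 - (2 * x) ^ 2)) / 8 +
      √(Real.log 2) * (1 / 2 * Real.log ((Real.pi ^ 2 - x ^ 2) / (1 - x ^ 2)) +
        Real.log (1 - x ^ 2) / (2 * x ^ 2) -
        Real.log (1 - x ^ 2 / Real.pi ^ 2) / (2 * x ^ 2)) + D * c₂) := by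
  have hp := Real.pi_gt_three
  have h1 := U₂_le hx hx1 hD
  have h2 := integral_singKer_mul_wt_le hx hx1 hR
  have h3 : R * x ^ 4 * (∫ y in 2 * x..1, wt y / y ^ 3) ≤ R * x ^ 4 * _ :=
    mul_le_mul_of_nonneg_left
      (integral_wt_div_cube_le (a := 2 * x) (by linarith) (by linarith)) (by positivity)
  have h4 := integral_wt_div_sub_near_le hx hx1
  have h5 := sqrt_log_two_mul_le hx hx1
  have hx2 : 0 < x ^ 2 := by positivity
  have e1 : Real.log (Real.pi ^ 2 - x ^ 2) =
      2 * Real.log Real.pi + Real.log (1 - x ^ 2 / Real.pi ^ 2) := by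
    have : 0 < 1 - x ^ 2 / Real.pi ^ 2 := by
      rw [sub_pos, div_lt_one (by positivity)]
      nlinarith
    rw [show 2 * Real.log Real.pi = Real.log (Real.pi ^ 2) by simp,
      ← Real.log_mul (by positivity) this.ne']
    congr 1
    field_simp
  have e2 : Real.log ((Real.pi ^ 2 - x ^ 2) / (1 - x ^ 2)) =
      Real.log (Real.pi ^ 2 - x ^ 2) - Real.log (1 - x ^ 2) :=
    Real.log_div (by nlinarith) (by nlinarith)
  rw [e2, e1]
  rw [e1] at h2
  set J := ∫ y in 2 * x..1, wt y / y
  set Q := ∫ y in 2 * x..1, wt y / y ^ 3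
  set S := ∫ y in x..Real.pi, singKer x y * (y * wt y)
  set K := (Real.log 3 - 4 / 3 * Real.log 2 + 1 / 9) / (2 * wt x * (1 + x))
  set A := √(Real.log (1 / (2 * x))) - (1 - (2 * x) ^ 2) / (2 * √(Real.log (1 / (2 * x)))) +
        √(Real.log 2) * (1 - (2 * x) ^ 2)
  set lam := Real.log (1 - x ^ 2 / Real.pi ^ 2)
  set mu := Real.log (1 - x ^ 2)
  set lp := Real.log Real.pi
  set s := √(Real.log 2)
  have h3' : R * x ^ 4 * Q ≤ x ^ 2 * (R * A / 8) := by
    refine h3.trans_eq ?_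
    field_simp
    ring
  have h45 := mul_le_mul_of_nonneg_left (add_le_add h4 h5) hx2.le
  have e3 : s * (Real.pi ^ 2 * lp - (Real.pi ^ 2 - x ^ 2) / 2 * (2 * lp + lam) +
      (1 - x ^ 2) / 2 * mu) = x ^ 2 * (s * (1 / 2 * (2 * lp + lam - mu) + mu / (2 * x ^ 2) -
        lam / (2 * x ^ 2))) + x ^ 2 * (s * (-((Real.pi ^ 2 - 1) * lam / (2 * x ^ 2)))) := by
    field_simp
    ring
  rw [e3] at h2
  norm_num at h1 h2 h45 ⊢
  nlinarith

lemma rpow_three_halves {t : ℝ} (ht : 0 ≤ t) : t ^ ((3 : ℝ) / 2) = t * √t := by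
  rw [Real.sqrt_eq_rpow, ← Real.rpow_one_add' ht (by norm_num)]
  norm_num

/-- Asymptotic bound for `U₂(x)/(−x²·log x·√(log(1 + 1/x)))` on `(0, ε]`. -/
theorem stmt_8 (ε : ℝ) (hε : 0 < ε) (hε2 : ε < 1 / 2)
    (R₂ : ℝ) (hR₂ : 0 ≤ R₂)
    (hR₂' : ∀ y ∈ Icc (0:ℝ) (1/4), -Real.log (1 - y) ≤ y + R₂ * y ^ 2)
    (D₁ : ℝ) (hD₁ : 0 ≤ D₁)
    (hD₁' : ∀ x ∈ Ioc (0:ℝ) ε,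
      -(Real.log (sinc ((Real.pi - x) / 2)) + Real.log (sinc ((Real.pi + x) / 2))
          - 2 * Real.log (sinc (Real.pi / 2))) ≤ D₁ * x ^ 2) :
    ∀ x ∈ Ioc (0:ℝ) ε,
      U₂ x / (-(x ^ 2 * Real.log x * Real.sqrt (Real.log (1 + 1 / x)))) ≤
        Real.log (16 / (3 * Real.sqrt 3)) / Real.log (1 / x)
        + ((2/3) * Real.log (1 / (2 * x)) ^ ((3:ℝ)/2)
              / (Real.log (1 / x) * Real.sqrt (Real.log (1 + 1 / x)))
          + R₂ * Real.sqrt (Real.log (1 / (2 * x)))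
              / (8 * Real.log (1 / x) * Real.sqrt (Real.log (1 + 1 / x)))
          - R₂ * (1 - 4 * x ^ 2)
              / (16 * Real.sqrt (Real.log (1 / (2 * x))) * Real.log (1 / x)
                  * Real.sqrt (Real.log (1 + 1 / x)))
          + Real.sqrt (Real.log 2) / Real.sqrt (Real.log (1 + 1 / x))
          - Real.log 2 ^ ((3:ℝ)/2)
              / (Real.log (1 / x) * Real.sqrt (Real.log (1 + 1 / x)))
          + R₂ * Real.sqrt (Real.log 2) * (1 - 4 * x ^ 2)
              / (8 * Real.log (1 / x) * Real.sqrt (Real.log (1 + 1 / x))))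
        + (Real.sqrt (Real.log 2)
              / (Real.log (1 / x) * Real.sqrt (Real.log (1 + 1 / x)))) *
            ((1/2) * Real.log ((Real.pi ^ 2 - x ^ 2) / (1 - x ^ 2))
              + Real.log (1 - x ^ 2) / (2 * x ^ 2)
              - Real.log (1 - x ^ 2 / Real.pi ^ 2) / (2 * x ^ 2))
        + D₁ * c₂ / (Real.log (1 / x) * Real.sqrt (Real.log (1 + 1 / x))) := by
  rintro x ⟨hx, hxε⟩
  have hp := Real.pi_gt_three
  have hx1 : x < 1 / 2 := by linarith
  have hD := hD₁' x ⟨hx, hxε⟩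
  rw [← log_kerRatio_pi hx (by linarith)] at hD
  have hU := U₂_le_sq_mul hx hx1 hR₂ hR₂' hD
  have hw := wt_pos hx
  have hL : 0 < Real.log (1 / (2 * x)) := Real.log_pos (by
    rw [lt_div_iff₀ (by linarith)]
    linarith)
  have hr := Real.sqrt_pos.2 hL
  have hL1 : Real.log (1 / x) = Real.log (1 / (2 * x)) + Real.log 2 := by
    rw [← Real.log_mul (by positivity) two_ne_zero]
    congr 1
    field_simp
  have h16 : Real.log (16 / (3 * √3)) = 4 * Real.log 2 - 3 / 2 * Real.log 3 := by
    rw [Real.log_div (by norm_num) (by positivity), Real.log_mul (by norm_num) (by positivity),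
      Real.log_sqrt (by norm_num), show (16 : ℝ) = 2 ^ 4 by norm_num, Real.log_pow]
    push_cast
    ring
  have hlx : Real.log x = -Real.log (1 / x) := by rw [one_div, Real.log_inv, neg_neg]
  have hq : 0 < Real.log 2 := Real.log_pos one_lt_two
  rw [rpow_three_halves hL.le, rpow_three_halves hq.le, h16, hlx, hL1]
  change _ / (-(_ * _ * wt x)) ≤ _ / _ + (_ / (_ * wt x) + _ / (_ * wt x) - _ / (_ * wt x) +
    _ / wt x - _ / (_ * wt x) + _ / (_ * wt x)) + _ / (_ * wt x) * _ + _ / (_ * wt x)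
  have hden : 0 < Real.log (1 / (2 * x)) + Real.log 2 := by linarith
  rw [mul_neg, neg_mul, neg_neg, div_le_iff₀ (by positivity)]
  refine hU.trans_eq ?_
  generalize Real.log ((Real.pi ^ 2 - x ^ 2) / (1 - x ^ 2)) = l₁
  generalize Real.log (1 - x ^ 2) = l₂
  generalize Real.log (1 - x ^ 2 / Real.pi ^ 2) = l₃
  generalize √(Real.log (1 / (2 * x))) = r at *
  generalize Real.log (1 / (2 * x)) = L at *
  generalize wt x = w at *
  field_simp
  ring
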